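/- Let S be a set of positive integers with 1 ∈ S, u its characteristic function, v_n = u(n) - u(n-1), and define h(E(S)) = ∏_p (1 + ∑_{i≥2} v_i / p^i) over all primes p. Then the infinite product converges to a value in [6/π², 1], and log h(E(S)) = ∑_{n=2}^∞ (f_n/n) P(n), where P(n) = ∑_p p^{-n} is the prime zeta function and f_n are the coefficients of the formal logarithm log(1 + ∑_{n≥2} v_n x^n) = ∑_{n≥2} (f_n/n) x^n. -/

import Mathlib

open scoped Classical

open PowerSeries

/-- A power series with coefficients of at most geometric growth converges absolutely. -/
lemma summable_norm_mul_pow_of_abs_le {a : ℕ → ℝ} {C b x : ℝ} (hb : 0 ≤ b)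
    (ha : ∀ n, |a n| ≤ C * b ^ n) (hx : b * |x| < 1) : Summable fun n => ‖a n * x ^ n‖ := by
  refine Summable.of_nonneg_of_le (fun n => norm_nonneg _) (fun n => ?_)
    ((summable_geometric_of_lt_one (by positivity) hx).mul_left C)
  rw [Real.norm_eq_abs, abs_mul, abs_pow, mul_pow, ← mul_assoc]
  exact mul_le_mul_of_nonneg_right (ha n) (by positivity)

lemma summable_norm_succ_mul_pow_of_abs_le {a : ℕ → ℝ} {C b x : ℝ} (hb : 0 ≤ b)
    (ha : ∀ n, |a n| ≤ C * b ^ n) (hx : b * |x| < 1) :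
    Summable fun n : ℕ => ‖((n : ℝ) + 1) * a (n + 1) * x ^ n‖ := by
  have hx' : ‖b * |x|‖ < 1 := by rwa [Real.norm_of_nonneg (by positivity)]
  have h1 := summable_pow_mul_geometric_of_norm_lt_one 1 hx'
  have h0 := summable_pow_mul_geometric_of_norm_lt_one 0 hx'
  refine Summable.of_nonneg_of_le (fun n => norm_nonneg _) (fun n => ?_)
    ((h1.add h0).mul_left (C * b))
  have h := mul_le_mul_of_nonneg_left (ha (n + 1))
    (by positivity : (0 : ℝ) ≤ (n + 1) * |x| ^ n)
  rw [Real.norm_eq_abs, abs_mul, abs_mul, abs_pow, abs_of_nonneg (by positivity : (0 : ℝ) ≤ n + 1)]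
  calc _ = (n + 1) * |x| ^ n * |a (n + 1)| := by ring
    _ ≤ _ := h
    _ = _ := by rw [mul_pow]; ring

/-- Termwise differentiation of a power series with coefficients of at most geometric growth. -/
lemma hasDerivAt_tsum_mul_pow {a : ℕ → ℝ} {C b x : ℝ} (hb : 0 ≤ b)
    (ha : ∀ n, |a n| ≤ C * b ^ n) (hx : b * |x| < 1) :
    HasDerivAt (fun y => ∑' n, a n * y ^ n) (∑' n : ℕ, ((n : ℝ) + 1) * a (n + 1) * x ^ n) x := by
  obtain ⟨r, hxr, hbr⟩ : ∃ r, |x| < r ∧ b * r < 1 := by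
    have hc : Filter.Tendsto (fun r => b * r) (nhdsWithin |x| (Set.Ioi |x|)) (nhds (b * |x|)) :=
      (Continuous.tendsto (by fun_prop) _).mono_left nhdsWithin_le_nhds
    have hgt : ∀ᶠ r in nhdsWithin |x| (Set.Ioi |x|), |x| < r := self_mem_nhdsWithin
    exact (hgt.and (hc.eventually_lt_const hx)).exists
  have hr : 0 < r := (abs_nonneg x).trans_lt hxr
  have hs := summable_norm_succ_mul_pow_of_abs_le hb ha (x := r) (by rwa [abs_of_pos hr])
  have hs' : Summable fun n : ℕ => ‖(n : ℝ) * a n * r ^ (n - 1)‖ := by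
    rw [← summable_nat_add_iff 1]
    simpa using hs
  have key := hasDerivAt_tsum_of_isPreconnected (g := fun n y => a n * y ^ n)
    (g' := fun n y => (n : ℝ) * a n * y ^ (n - 1)) (t := Set.Ioo (-r) r) (y₀ := 0) (y := x)
    hs' isOpen_Ioo isPreconnected_Ioo
    (fun n y _ => ((hasDerivAt_pow n y).const_mul (a n)).congr_deriv (by ring))
    (fun n y hy => by
      rw [norm_mul, norm_mul _ (r ^ (n - 1)), norm_pow, norm_pow, Real.norm_of_nonneg hr.le]
      exact mul_le_mul_of_nonneg_left
        (pow_le_pow_left₀ (norm_nonneg _) (abs_lt.mpr hy).le _) (norm_nonneg _))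
    ⟨by linarith, hr⟩ (summable_norm_mul_pow_of_abs_le hb ha (by simp)).of_norm
    (abs_lt.mp hxr)
  refine key.congr_deriv ?_
  have hx1 : Summable fun n : ℕ => (n : ℝ) * a n * x ^ (n - 1) := by
    rw [← summable_nat_add_iff 1]
    simpa using (summable_norm_succ_mul_pow_of_abs_le hb ha hx).of_norm
  rw [hx1.tsum_eq_zero_add]
  simp

/-- If the coefficients satisfy the formal identity `g' = g * l'`, `g 0 = 1`, `l 0 = 0`, then the
sums of the power series satisfy `g = exp l` inside the disc of convergence. -/
lemma tsum_mul_pow_eq_exp {g l : ℕ → ℝ} {C b x : ℝ} (hb : 0 < b)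
    (hg : ∀ n, |g n| ≤ C * b ^ n) (hl : ∀ n, |l n| ≤ C * b ^ n) (hg0 : g 0 = 1) (hl0 : l 0 = 0)
    (hgl : ∀ n : ℕ, ((n : ℝ) + 1) * g (n + 1) =
      ∑ p ∈ Finset.HasAntidiagonal.antidiagonal n, g p.1 * (((p.2 : ℝ) + 1) * l (p.2 + 1)))
    (hx : b * |x| < 1) :
    ∑' n, g n * x ^ n = Real.exp (∑' n, l n * x ^ n) := by
  have hmem : ∀ y ∈ Set.Ioo (-b⁻¹) b⁻¹, b * |y| < 1 := fun y hy => by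
    have := mul_lt_mul_of_pos_left (abs_lt.mpr hy) hb
    rwa [mul_inv_cancel₀ hb.ne'] at this
  have hxm : x ∈ Set.Ioo (-b⁻¹) b⁻¹ := by
    rw [Set.mem_Ioo, ← abs_lt]
    exact (lt_inv_mul_iff₀ hb).mpr hx |>.trans_eq (mul_one _)
  have hD : ∀ y ∈ Set.Ioo (-b⁻¹) b⁻¹, HasDerivAt
      (fun z => (∑' n, g n * z ^ n) * Real.exp (-∑' n, l n * z ^ n)) 0 y := fun y hy => by
    have h1 := hasDerivAt_tsum_mul_pow hb.le hg (hmem y hy)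
    have h2 := hasDerivAt_tsum_mul_pow hb.le hl (hmem y hy)
    have hprod : ∑' n : ℕ, ((n : ℝ) + 1) * g (n + 1) * y ^ n =
        (∑' n, g n * y ^ n) * ∑' n : ℕ, ((n : ℝ) + 1) * l (n + 1) * y ^ n := by
      rw [tsum_mul_tsum_eq_tsum_sum_antidiagonal_of_summable_norm
        (summable_norm_mul_pow_of_abs_le hb.le hg (hmem y hy))
        (summable_norm_succ_mul_pow_of_abs_le hb.le hl (hmem y hy))]
      refine tsum_congr fun n => ?_
      rw [hgl, Finset.sum_mul]
      refine Finset.sum_congr rfl fun p hp => ?_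
      rw [← Finset.HasAntidiagonal.mem_antidiagonal.mp hp, pow_add]
      ring
    refine (h1.mul h2.neg.exp).congr_deriv ?_
    rw [hprod]
    ring
  have h0 : (0 : ℝ) ∈ Set.Ioo (-b⁻¹) b⁻¹ := by simp [hb]
  have hc := isOpen_Ioo.is_const_of_deriv_eq_zero isPreconnected_Ioo
    (fun y hy => (hD y hy).differentiableAt.differentiableWithinAt)
    (fun y hy => (hD y hy).deriv) hxm h0
  have hat0 : ∀ a : ℕ → ℝ, ∑' n, a n * (0 : ℝ) ^ n = a 0 := fun a => by
    rw [tsum_eq_single 0 fun n hn => by simp [hn]]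
    simp
  simp only [hat0, hg0, hl0, Real.exp_neg, Real.exp_zero, inv_one, mul_one] at hc
  exact eq_of_div_eq_one (by rwa [div_eq_mul_inv])

/-- Growth of the coefficients of the logarithmic derivative of `1 + g₂ x² + g₃ x³ + ⋯` when
`|gₙ| ≤ 1`. -/
lemma abs_logDeriv_coeff_le {g h : ℕ → ℝ} (hg : ∀ n, |g n| ≤ 1) (hg0 : g 0 = 1) (hg1 : g 1 = 0)
    (hgh : ∀ n : ℕ, ((n : ℝ) + 1) * g (n + 1) = ∑ p ∈ Finset.HasAntidiagonal.antidiagonal n, g p.1 * h p.2)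
    (n : ℕ) : |h n| ≤ 4 * (7 / 4) ^ n := by
  induction n using Nat.strong_induction_on with
  | _ n ih =>
    cases n with
    | zero =>
      have h0 := hgh 0
      simp [hg0, hg1] at h0
      simp [← h0]
    | succ m =>
      have hm := hgh (m + 1)
      rw [← Finset.Nat.sum_antidiagonal_swap,
        Finset.Nat.sum_antidiagonal_eq_sum_range_succ_mk, Finset.sum_range_succ,
        Finset.sum_range_succ] at hm
      simp only [Prod.swap, Nat.sub_self, hg0, Nat.add_sub_cancel_left, hg1, one_mul, zero_mul,
        add_zero] at hm
      have hsum : |∑ j ∈ Finset.range m, g (m + 1 - j) * h j| ≤ 4 * (((7 / 4) ^ m - 1) / (3 / 4)) := by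
        calc _ ≤ ∑ j ∈ Finset.range m, |g (m + 1 - j) * h j| := Finset.abs_sum_le_sum_abs _ _
          _ ≤ ∑ j ∈ Finset.range m, 4 * (7 / 4 : ℝ) ^ j := by
            refine Finset.sum_le_sum fun j hj => ?_
            rw [abs_mul]
            have := mul_le_mul_of_nonneg_right (hg (m + 1 - j)) (abs_nonneg (h j))
            rw [one_mul] at this
            exact this.trans (ih j ((Finset.mem_range.mp hj).trans (Nat.lt_succ_self m)))
          _ = _ := by
            rw [← Finset.mul_sum, geom_sum_eq (by norm_num)]
            norm_num
      have hgm : |((m + 1 : ℕ) + 1 : ℝ) * g (m + 1 + 1)| ≤ m + 2 := by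
        rw [abs_mul, abs_of_nonneg (by positivity)]
        have := mul_le_mul_of_nonneg_left (hg (m + 1 + 1))
          (by positivity : (0 : ℝ) ≤ (m + 1 : ℕ) + 1)
        push_cast at this ⊢
        linarith
      have hb := one_add_mul_le_pow (by norm_num : (-2 : ℝ) ≤ 3 / 4) m
      norm_num at hb
      have heq : h (m + 1) = ((m + 1 : ℕ) + 1 : ℝ) * g (m + 1 + 1) -
          ∑ j ∈ Finset.range m, g (m + 1 - j) * h j := by linarith
      rw [heq, pow_succ]
      refine (abs_sub _ _).trans ?_
      have hm0 : (0 : ℝ) ≤ m := m.cast_nonneg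
      linarith

/-- The Euler factor of a set with indicator `u` at `x = 1/p` lies in `[1 - x², 1]`. -/
lemma tsum_sub_mul_pow_mem_Icc {u : ℕ → ℝ} (hu : ∀ n, u n ∈ Set.Icc (0 : ℝ) 1) (hu1 : u 1 = 1)
    {x : ℝ} (hx0 : 0 ≤ x) (hx1 : x < 1) :
    ∑' i, (u (i + 2) - u (i + 1)) * x ^ (i + 2) ∈ Set.Icc (-x ^ 2) 0 := by
  have hgeo := (summable_geometric_of_lt_one hx0 hx1).mul_left (x ^ 2)
  have hle : ∀ i, u (i + 2) * x ^ (i + 2) ≤ x ^ 2 * x ^ i := fun i => by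
    rw [pow_add, mul_comm (x ^ i)]
    exact mul_le_of_le_one_left (by positivity) (hu _).2
  have hnn : ∀ i, 0 ≤ u (i + 2) * x ^ (i + 2) := fun i => mul_nonneg (hu _).1 (by positivity)
  have hs : Summable fun i => u (i + 2) * x ^ (i + 2) := .of_nonneg_of_le hnn hle hgeo
  have hs1 : Summable fun i => u (i + 1) * x ^ (i + 1) := by
    rwa [← summable_nat_add_iff 1]
  have hA0 : 0 ≤ ∑' i, u (i + 2) * x ^ (i + 2) := tsum_nonneg hnn
  have hA1 := hs.tsum_le_tsum hle hgeo
  rw [tsum_mul_left, tsum_geometric_of_lt_one hx0 hx1] at hA1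
  have hA2 : (∑' i, u (i + 2) * x ^ (i + 2)) * (1 - x) ≤ x ^ 2 := by
    have := mul_le_mul_of_nonneg_right hA1 (sub_nonneg.mpr hx1.le)
    rwa [mul_assoc, inv_mul_cancel₀ (by linarith), mul_one] at this
  have hsplit : ∑' i, (u (i + 2) - u (i + 1)) * x ^ (i + 2) =
      (∑' i, u (i + 2) * x ^ (i + 2)) * (1 - x) - x ^ 2 := by
    have h1 := hs1.tsum_eq_zero_add
    simp only [zero_add, hu1, pow_one, one_mul] at h1
    calc _ = ∑' i, (u (i + 2) * x ^ (i + 2) - x * (u (i + 1) * x ^ (i + 1))) :=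
          tsum_congr fun i => by ring
      _ = _ := by
        rw [hs.tsum_sub (hs1.mul_left x), tsum_mul_left, h1]
        ring
  rw [hsplit]
  exact ⟨by nlinarith [mul_nonneg hA0 (sub_nonneg.mpr hx1.le)], by linarith⟩

lemma hasProd_primes_inv_one_sub_inv_sq :
    HasProd (fun p : Nat.Primes => (1 - (1 / (p : ℝ)) ^ 2)⁻¹) (Real.pi ^ 2 / 6) := by
  let f : ℕ →*₀ ℝ :=
    { toFun := fun n => (1 / (n : ℝ)) ^ 2
      map_zero' := by simp
      map_one' := by simp
      map_mul' := fun m n => by push_cast; rw [← mul_pow, div_mul_div_comm, one_mul] }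
  have hf : HasSum f (Real.pi ^ 2 / 6) := by
    simpa [f, one_div] using hasSum_zeta_two
  have := EulerProduct.eulerProduct_completely_multiplicative_hasProd (f := f) hf.summable.norm
  rwa [hf.tsum_eq] at this

/-- Let `u` be the characteristic function of a set `S ∋ 1`,
`v n = u n - u (n-1)`, `f` the logarithmic coefficients of `1 + ∑_{n≥2} v_n x^n`
(defined by `G' = G·H` with `H = ∑_{j≥1} f_{j+1} x^j`), and
`P n = ∑_p p^{-n}` the prime zeta function. Then the Euler product
`h = ∏_p (1 + ∑_{i≥2} v_i p^{-i})` converges to a value in `[6/π², 1]` and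
`log h = ∑_{n≥2} (f_n/n) P(n)`. -/
theorem stmt13 (S : Set ℕ) (hS1 : (1 : ℕ) ∈ S) (hS0 : ∀ s ∈ S, 1 ≤ s)
    (u v : ℕ → ℝ) (hu : ∀ n, u n = if n ∈ S then 1 else 0)
    (hv : ∀ n ≥ 2, v n = u n - u (n - 1))
    (f : ℕ → ℝ) (G H : PowerSeries ℝ)
    (hG : G = PowerSeries.mk fun n => if n = 0 then 1 else if n = 1 then 0 else v n)
    (hH : H = PowerSeries.mk fun j => if j = 0 then 0 else f (j + 1))
    (hlog : PowerSeries.derivativeFun G = G * H)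
    (P : ℕ → ℝ) (hP : ∀ n, P n = ∑' p : Nat.Primes, 1 / (p : ℝ) ^ n)
    (loc : Nat.Primes → ℝ)
    (hloc : ∀ p : Nat.Primes, loc p = 1 + ∑' i : ℕ, v (i + 2) / (p : ℝ) ^ (i + 2)) :
    Multipliable loc ∧
    6 / Real.pi ^ 2 ≤ ∏' p : Nat.Primes, loc p ∧
    (∏' p : Nat.Primes, loc p) ≤ 1 ∧
    Real.log (∏' p : Nat.Primes, loc p) =
      ∑' n : ℕ, f (n + 2) / ((n : ℝ) + 2) * P (n + 2) := by
  have hu1 : u 1 = 1 := by simp [hu, hS1]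
  have huI : ∀ n, u n ∈ Set.Icc (0 : ℝ) 1 := fun n => by
    rw [hu]
    split_ifs <;> simp
  have hvu : ∀ i, v (i + 2) = u (i + 2) - u (i + 1) := fun i => hv (i + 2) (by omega)
  set g : ℕ → ℝ := fun n => if n = 0 then 1 else if n = 1 then 0 else v n
  set h : ℕ → ℝ := fun j => if j = 0 then 0 else f (j + 1)
  have hg_abs : ∀ n, |g n| ≤ 1
    | 0 => by simp [g]
    | 1 => by simp [g]
    | n + 2 => by
      simp only [g, Nat.add_eq_zero_iff, OfNat.ofNat_ne_zero, and_false, if_false, hvu,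
        show n + 2 ≠ 1 by omega]
      exact abs_le.mpr ⟨by linarith [(huI (n + 2)).1, (huI (n + 1)).2],
        by linarith [(huI (n + 2)).2, (huI (n + 1)).1]⟩
  have hgh : ∀ n : ℕ, ((n : ℝ) + 1) * g (n + 1) =
      ∑ p ∈ Finset.HasAntidiagonal.antidiagonal n, g p.1 * h p.2 := fun n => by
    have := congrArg (PowerSeries.coeff n) hlog
    rw [PowerSeries.coeff_mul] at this
    simp only [hG, hH, PowerSeries.coeff_mk] at this
    rw [← this, mul_comm]
    exact ((PowerSeries.coeff_derivative _ _).trans (by rw [PowerSeries.coeff_mk])).symm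
  have hh_abs := abs_logDeriv_coeff_le hg_abs (by simp [g]) (by simp [g]) hgh
  set l : ℕ → ℝ := fun n => h (n - 1) / n
  have hl0 : l 0 = 0 := by simp [l]
  have hl1 : l 1 = 0 := by simp [l, h]
  have hl2 : ∀ n, l (n + 2) = f (n + 2) / ((n : ℝ) + 2) := fun n => by simp [l, h]
  have hlh : ∀ n : ℕ, ((n : ℝ) + 1) * l (n + 1) = h n := fun n => by
    simp only [l, Nat.add_sub_cancel]
    push_cast
    field_simp
  have hl_abs : ∀ n, |l n| ≤ 4 * (7 / 4) ^ n
    | 0 => by simp [l]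
    | n + 1 => by
      have h1 : |((n : ℝ) + 1) * l (n + 1)| ≤ 4 * (7 / 4) ^ n := by rw [hlh]; exact hh_abs n
      rw [abs_mul, abs_of_nonneg (by positivity)] at h1
      have h2 : (0 : ℝ) ≤ n * |l (n + 1)| := by positivity
      have h3 : (0 : ℝ) < (7 / 4) ^ n := by positivity
      rw [pow_succ]
      linarith
  have hg_abs' : ∀ n, |g n| ≤ 4 * (7 / 4) ^ n := fun n => by
    have := one_le_pow₀ (by norm_num : (1 : ℝ) ≤ 7 / 4) (n := n)
    linarith [hg_abs n]
  have hx0 : ∀ p : Nat.Primes, (0 : ℝ) < 1 / (p : ℝ) := fun p => by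
    have := p.2.pos
    positivity
  have hx2 : ∀ p : Nat.Primes, 1 / (p : ℝ) ≤ 1 / 2 := fun p =>
    one_div_le_one_div_of_le (by norm_num) (by exact_mod_cast p.2.two_le)
  have hx : ∀ p : Nat.Primes, 7 / 4 * |1 / (p : ℝ)| < 1 := fun p => by
    rw [abs_of_pos (hx0 p)]
    linarith [hx2 p]
  have hloc_tsum : ∀ p : Nat.Primes, loc p =
      1 + ∑' i, (u (i + 2) - u (i + 1)) * (1 / (p : ℝ)) ^ (i + 2) := fun p => by
    rw [hloc]
    simp only [hvu, div_eq_mul_inv, one_mul, inv_pow]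
  have hloc_mem : ∀ p : Nat.Primes, loc p ∈ Set.Icc (1 - (1 / (p : ℝ)) ^ 2) 1 := fun p => by
    have := tsum_sub_mul_pow_mem_Icc huI hu1 (hx0 p).le (by linarith [hx2 p])
    rw [hloc_tsum]
    exact ⟨by linarith [this.1], by linarith [this.2]⟩
  have hloc_pos : ∀ p, 0 < loc p := fun p => by
    refine lt_of_lt_of_le ?_ (hloc_mem p).1
    nlinarith [hx0 p, hx2 p]
  have hlog_loc : ∀ p : Nat.Primes,
      Real.log (loc p) = ∑' n, l (n + 2) * (1 / (p : ℝ)) ^ (n + 2) := fun p => by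
    have hexp := tsum_mul_pow_eq_exp (by norm_num) hg_abs' hl_abs (by simp [g]) hl0
      (by simpa only [hlh] using hgh) (hx p)
    rw [← (summable_norm_mul_pow_of_abs_le (by norm_num) hg_abs' (hx p)).of_norm.sum_add_tsum_nat_add
        2, ← (summable_norm_mul_pow_of_abs_le (by norm_num) hl_abs (hx p)).of_norm.sum_add_tsum_nat_add
        2] at hexp
    simp only [Finset.sum_range_succ, Finset.sum_range_zero, hl0, hl1, zero_mul, zero_add] at hexp
    rw [← Real.log_exp (∑' n, _), ← hexp, hloc_tsum]
    simp [g, hvu]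
  have hsq : Summable fun p : Nat.Primes => (1 / (p : ℝ)) ^ 2 := by
    have := Nat.Primes.summable_rpow.mpr (by norm_num : (-2 : ℝ) < -1)
    refine this.congr fun p => ?_
    rw [Real.rpow_neg (by positivity), one_div, inv_pow]
    norm_cast
  have hdouble : Summable (Function.uncurry fun (p : Nat.Primes) (n : ℕ) =>
      l (n + 2) * (1 / (p : ℝ)) ^ (n + 2)) := by
    have hgeo : Summable fun n : ℕ => 4 * (7 / 4) ^ 2 * (7 / 8 : ℝ) ^ n :=
      (summable_geometric_of_lt_one (by norm_num) (by norm_num)).mul_left _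
    refine Summable.of_norm_bounded (hsq.mul_of_nonneg hgeo (fun p => by positivity)
      (fun n => by positivity)) fun ⟨p, n⟩ => ?_
    simp only [Function.uncurry_apply_pair]
    rw [Real.norm_eq_abs, abs_mul, abs_pow, abs_of_pos (hx0 p)]
    calc _ ≤ 4 * (7 / 4) ^ (n + 2) * ((1 / 2) ^ n * (1 / (p : ℝ)) ^ 2) := by
          refine mul_le_mul (hl_abs _) ?_ (pow_nonneg (hx0 p).le _) (by positivity)
          rw [pow_add]
          exact mul_le_mul_of_nonneg_right (pow_le_pow_left₀ (hx0 p).le (hx2 p) n) (by positivity)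
      _ = _ := by
          rw [pow_add, show (7 / 8 : ℝ) = 7 / 4 * (1 / 2) by norm_num, mul_pow]
          ring
  have hlog_summable : Summable fun p => Real.log (loc p) := by
    simp only [hlog_loc]
    exact hdouble.prod
  have hmul := Real.multipliable_of_summable_log hloc_pos hlog_summable
  refine ⟨hmul, ?_, ?_, ?_⟩
  · have hge : 1 ≤ (∏' p, loc p) * (Real.pi ^ 2 / 6) := by
      refine ge_of_tendsto' (hmul.hasProd.mul hasProd_primes_inv_one_sub_inv_sq) fun s => ?_
      refine Finset.prod_induction _ (1 ≤ ·) (fun _ _ => one_le_mul_of_one_le_of_one_le) le_rfl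
        fun p _ => ?_
      have hpos : 0 < 1 - (1 / (p : ℝ)) ^ 2 := by nlinarith [hx0 p, hx2 p]
      rw [← div_eq_mul_inv, one_le_div hpos]
      exact (hloc_mem p).1
    have hpi : 0 < Real.pi ^ 2 := by positivity
    rw [div_le_iff₀ hpi]
    linarith
  · exact le_of_tendsto' hmul.hasProd fun s =>
      Finset.prod_le_one (fun p _ => (hloc_pos p).le) fun p _ => (hloc_mem p).2
  · rw [← Real.rexp_tsum_eq_tprod hloc_pos hlog_summable, Real.log_exp]
    simp only [hlog_loc]
    rw [← hdouble.tsum_comm]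
    refine tsum_congr fun n => ?_
    rw [tsum_mul_left, hl2, hP]
    simp only [one_div, inv_pow]
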